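/- Every fixed-point solution s of the TTC mean-field equations satisfies s_i ≤ λ s_{i−1} s_{i−T−1} for all i ≥ 1. -/

import Mathlib

/-- A fixed-point solution of the TTC mean-field equations with threshold `T` and
arrival rate `λ`: a nonincreasing sequence `s : ℤ → ℝ` with values in `[0,1]`,
equal to `1` on nonpositive indices, tending to `0` at `+∞`, and satisfying
`s_i − s_{i+1} = λ p_{i−1}(s_{i−T−1} + s_{i+T})` for all `i ≥ 1`,
where `p_i = s_i − s_{i+1}`. -/
def IsTTCFixedPoint (T : ℕ) (lam : ℝ) (s : ℤ → ℝ) : Prop :=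
  Antitone s ∧ (∀ i, 0 ≤ s i ∧ s i ≤ 1) ∧ (∀ j : ℤ, j ≤ 0 → s j = 1) ∧
    Filter.Tendsto s Filter.atTop (nhds 0) ∧
    ∀ i : ℤ, 1 ≤ i →
      s i - s (i + 1) = lam * (s (i - 1) - s i) * (s (i - T - 1) + s (i + T))

open Filter Topology

/-- The potential whose decrement is the right-hand side of the mean-field equation. -/
noncomputable def ttcPotential (T : ℕ) (s : ℤ → ℝ) (i : ℤ) : ℝ :=
  s (i - 1) * s (i + T) +
    ∑ k ∈ Finset.range (T + 1), (s (i - 1 + k) - s (i + k)) * s (i - 1 + k - T)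

lemma ttcPotential_sub_succ (T : ℕ) (s : ℤ → ℝ) (i : ℤ) :
    ttcPotential T s i - ttcPotential T s (i + 1) =
      (s (i - 1) - s i) * (s (i - T - 1) + s (i + T)) := by
  have key := Finset.sum_range_succ' (fun k : ℕ =>
    (s (i - 1 + k) - s (i + k)) * s (i - 1 + k - T)) (T + 1)
  rw [Finset.sum_range_succ] at key
  have shift : ∑ k ∈ Finset.range (T + 1),
      (s (i + 1 - 1 + k) - s (i + 1 + k)) * s (i + 1 - 1 + k - T) =
      ∑ k ∈ Finset.range (T + 1), (s (i - 1 + (k + 1 : ℕ)) - s (i + (k + 1 : ℕ))) *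
        s (i - 1 + (k + 1 : ℕ) - T) := by
    refine Finset.sum_congr rfl fun k _ => ?_
    push_cast
    ring_nf
  unfold ttcPotential
  rw [shift, eq_sub_of_add_eq key.symm]
  have e1 : i - 1 + ((T + 1 : ℕ) : ℤ) = i + T := by push_cast; ring
  have e2 : i + ((T + 1 : ℕ) : ℤ) = i + 1 + T := by push_cast; ring
  have e3 : i + (T : ℤ) - T = i := by ring
  have e4 : i - 1 - (T : ℤ) = i - T - 1 := by ring
  simp only [e1, e2, e3, e4, Nat.cast_zero, add_zero, add_sub_cancel_right]
  ring

lemma sum_decrement_mul_le {s : ℤ → ℝ} (hs : Antitone s) (T : ℕ) (i : ℤ) (n : ℕ) :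
    ∑ k ∈ Finset.range n, (s (i - 1 + k) - s (i + k)) * s (i - 1 + k - T) ≤
      s (i - T - 1) * (s (i - 1) - s (i - 1 + n)) := by
  induction n with
  | zero => simp
  | succ n ih =>
    rw [Finset.sum_range_succ]
    have e : i - 1 + ((n + 1 : ℕ) : ℤ) = i + n := by push_cast; ring
    have hd : 0 ≤ s (i - 1 + n) - s (i + n) := sub_nonneg.2 (hs (by lia))
    have hm := mul_le_mul_of_nonneg_left
      (hs (show i - T - 1 ≤ i - 1 + n - T by lia)) hd
    rw [e]
    linarith

lemma ttcPotential_le {s : ℤ → ℝ} (hs : Antitone s) (h0 : ∀ i, 0 ≤ s i) (T : ℕ) (i : ℤ) :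
    ttcPotential T s i ≤ s (i - 1) * s (i - T - 1) := by
  have h := sum_decrement_mul_le hs T i (T + 1)
  have e : i - 1 + ((T + 1 : ℕ) : ℤ) = i + T := by push_cast; ring
  rw [e] at h
  have hm := mul_le_mul_of_nonneg_left
    (hs (show i - T - 1 ≤ i - 1 by lia)) (h0 (i + T))
  unfold ttcPotential
  linarith

lemma ttcPotential_nonneg {s : ℤ → ℝ} (hs : Antitone s) (h0 : ∀ i, 0 ≤ s i) (T : ℕ) (i : ℤ) :
    0 ≤ ttcPotential T s i :=
  add_nonneg (mul_nonneg (h0 _) (h0 _)) <| Finset.sum_nonneg fun _ _ =>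
    mul_nonneg (sub_nonneg.2 (hs (by lia))) (h0 _)

lemma tendsto_ttcPotential {s : ℤ → ℝ} (hs : Antitone s) (h0 : ∀ i, 0 ≤ s i)
    (hlim : Tendsto s atTop (𝓝 0)) (T : ℕ) : Tendsto (ttcPotential T s) atTop (𝓝 0) := by
  have hshift (c : ℤ) : Tendsto (fun i => s (i + c)) atTop (𝓝 0) :=
    hlim.comp (tendsto_atTop_add_const_right _ c tendsto_id)
  have hprod : Tendsto (fun i : ℤ => s (i - 1) * s (i - T - 1)) atTop (𝓝 0) := by
    have h := (hshift (-1)).mul (hshift (-T - 1))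
    rw [mul_zero] at h
    refine h.congr fun i => ?_
    ring_nf
  exact squeeze_zero (ttcPotential_nonneg hs h0 T) (ttcPotential_le hs h0 T) hprod

/-- A fixed point equals `λ` times its potential on positive indices. -/
lemma IsTTCFixedPoint.eq_mul_ttcPotential {T : ℕ} {lam : ℝ} {s : ℤ → ℝ}
    (hs : IsTTCFixedPoint T lam s) {i : ℤ} (hi : 1 ≤ i) :
    s i = lam * ttcPotential T s i := by
  obtain ⟨hanti, hbd, -, hlim, heq⟩ := hs
  have hconst : ∀ j, i ≤ j →
      s j - lam * ttcPotential T s j = s i - lam * ttcPotential T s i := by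
    intro j hj
    induction j, hj using Int.leInduction with
    | base => rfl
    | succ j hj ih =>
      have h1 := heq j (hi.trans hj)
      have h2 := ttcPotential_sub_succ T s j
      linear_combination ih - h1 + lam * h2
  have ht : Tendsto (fun j => s j - lam * ttcPotential T s j) atTop (𝓝 0) := by
    simpa using hlim.sub
      ((tendsto_ttcPotential hanti (fun j => (hbd j).1) hlim T).const_mul lam)
  have hc := tendsto_nhds_unique (tendsto_const_nhds.congr'
    ((eventually_ge_atTop i).mono fun j hj => (hconst j hj).symm)) ht
  linarith

/-- Every fixed-point solution `s` of the TTC mean-field equations satisfies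
`s_i ≤ λ s_{i−1} s_{i−T−1}` for all `i ≥ 1`. -/
theorem ttc_fixed_point_key_bound (T : ℕ) (hT : 1 ≤ T) (lam : ℝ)
    (h0 : 0 < lam) (h1 : lam < 1)
    (s : ℤ → ℝ) (hs : IsTTCFixedPoint T lam s) :
    ∀ i : ℤ, 1 ≤ i → s i ≤ lam * s (i - 1) * s (i - T - 1) := by
  intro i hi
  rw [hs.eq_mul_ttcPotential hi, mul_assoc]
  exact mul_le_mul_of_nonneg_left
    (ttcPotential_le hs.1 (fun j => (hs.2.1 j).1) T i) h0.le
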